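/- In the setting of the Poincaré realization above, define additionally Λ̂_{μν} = (e^∂)_{μν}, where ∂ = [∂_{μν}] and the η-contracted matrix powers are (∂⁰)_{μν} = η_{μν}, (∂^m)_{μν} = Σ_{α,β}(∂^{m-1})_{μα} η_{αβ} ∂_{βν}, with (e^∂)_{μν} = Σ_{m≥0}(1/m!)(∂^m)_{μν}. Then for all indices: [M̂_{μν}, Λ̂_{ρσ}] = η_{νρ} Λ̂_{μσ} - η_{μρ} Λ̂_{νσ}, [P̂_μ, Λ̂_{ρσ}] = 0, and [Λ̂_{μν}, Λ̂_{ρσ}] = 0; i.e., the operators P̂_μ, M̂_{μν}, Λ̂_{μν} realize the Poincaré algebra extended by quantum angles. -/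

import Mathlib

open MvPolynomial

/-- Index set: pair indices for `x_{μν}` (`μ < ν`) and single indices for `p_μ`. -/
abbrev PIdx (n : ℕ) := {q : Fin n × Fin n // q.1 < q.2} ⊕ Fin n

/-- The polynomial algebra `P = ℝ[x_{μν} (1 ≤ μ < ν ≤ n), p_μ (1 ≤ μ ≤ n)]`. -/
abbrev PolyP (n : ℕ) := MvPolynomial (PIdx n) ℝ

/-- The Minkowski metric `η = diag(-1,1,…,1)`. -/
def etaM {n : ℕ} (μ ν : Fin n) : ℝ :=
  if μ = ν then (if (μ : ℕ) = 0 then -1 else 1) else 0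

/-- The antisymmetric family of variables: `x_{νμ} = -x_{μν}`, `x_{μμ} = 0`. -/
noncomputable def xv {n : ℕ} (μ ν : Fin n) : PolyP n :=
  if h : μ < ν then X (Sum.inl ⟨(μ, ν), h⟩)
  else if h : ν < μ then - X (Sum.inl ⟨(ν, μ), h⟩) else 0

/-- The variables `p_μ`. -/
noncomputable def pvar {n : ℕ} (μ : Fin n) : PolyP n := X (Sum.inr μ)

/-- Derivations `∂_{μν}` with `[∂_{μν},x_{αβ}] = η_{μα}η_{νβ} - η_{μβ}η_{να}`,
`[∂_{μν},p_α] = 0`, and `∂_{νμ} = -∂_{μν}`. -/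
noncomputable def dpair {n : ℕ} (μ ν : Fin n) : PolyP n → PolyP n := fun p =>
  if h : μ < ν then (etaM μ μ * etaM ν ν) • pderiv (Sum.inl ⟨(μ, ν), h⟩) p
  else if h : ν < μ then - ((etaM μ μ * etaM ν ν) • pderiv (Sum.inl ⟨(ν, μ), h⟩) p) else 0

/-- Derivations `∂_μ` with `[∂_μ,p_ν] = η_{μν}` and `[∂_μ,x_{αβ}] = 0`. -/
noncomputable def dsingle {n : ℕ} (μ : Fin n) : PolyP n → PolyP n := fun p =>
  etaM μ μ • pderiv (Sum.inr μ) p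

/-- The block `C_{(μν)α} = η_{αμ}∂_ν - η_{αν}∂_μ` of `K̃`. -/
noncomputable def Cblock {n : ℕ} (μ ν α : Fin n) : PolyP n → PolyP n := fun p =>
  etaM α μ • dsingle ν p - etaM α ν • dsingle μ p

/-- The block `D_{(μν)(αβ)} = (1/2)(η_{μα}∂_{νβ} - η_{μβ}∂_{να} + η_{νβ}∂_{μα} - η_{να}∂_{μβ})`. -/
noncomputable def Dblock {n : ℕ} (μ ν α β : Fin n) : PolyP n → PolyP n := fun p =>
  (1/2 : ℝ) • (etaM μ α • dpair ν β p - etaM μ β • dpair ν α p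
    + etaM ν β • dpair μ α p - etaM ν α • dpair μ β p)

/-- Single-single block of `K̃^m`: the `η`-contracted powers of `A = [∂_{μν}]`,
`(A⁰)_{μν} = η_{μν}`, `(A^m)_{μν} = Σ (A^{m-1})_{μα} η_{αβ} A_{βν}`. -/
noncomputable def Apow {n : ℕ} : ℕ → Fin n → Fin n → (PolyP n → PolyP n)
  | 0 => fun μ ν p => etaM μ ν • p
  | m+1 => fun μ ν p => ∑ α, ∑ β, etaM α β • Apow m μ α (dpair β ν p)

/-- Pair-pair block of `K̃^m`: the `η`-contracted powers of `D`. -/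
noncomputable def Dpow {n : ℕ} : ℕ → Fin n → Fin n → Fin n → Fin n → (PolyP n → PolyP n)
  | 0 => fun μ ν α β p => ((1/2 : ℝ) * (etaM μ α * etaM ν β - etaM μ β * etaM ν α)) • p
  | m+1 => fun μ ν α β p => ∑ lam, ∑ ρ, ∑ lam', ∑ ρ',
      (etaM lam lam' * etaM ρ ρ') • Dblock μ ν lam ρ (Dpow m lam' ρ' α β p)

/-- Pair-single block of `K̃^m` (equal to `Σ_{k=0}^{m-1} D^k C A^{m-k-1}`), computed
recursively by `LL(0) = 0`, `LL(m+1) = C·η·A^m + D·η·η·LL(m)`. -/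
noncomputable def LLpow {n : ℕ} : ℕ → Fin n → Fin n → Fin n → (PolyP n → PolyP n)
  | 0 => fun _ _ _ _ => 0
  | m+1 => fun μ ν α p =>
      (∑ lam, ∑ lam', etaM lam lam' • Cblock μ ν lam (Apow m lam' α p))
        + ∑ θ, ∑ σ, ∑ θ', ∑ σ',
            (etaM θ θ' * etaM σ σ') • Dblock μ ν θ σ (LLpow m θ' σ' α p)

/-- The coefficient `(-1)^k B_k / k!` of `ψ(t) = t/(1-e^{-t})` (`B₁ = -1/2`). -/
noncomputable def bcoef (k : ℕ) : ℝ := (-1 : ℝ)^k * ((bernoulli k : ℚ) : ℝ) / (k.factorial : ℝ)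

/-- `ψ(K̃)` on the single-single block. -/
noncomputable def psiA {n : ℕ} (μ ν : Fin n) : PolyP n → PolyP n := fun p =>
  ∑ᶠ k : ℕ, bcoef k • Apow k μ ν p

/-- `ψ(K̃)` on the pair-pair block. -/
noncomputable def psiD {n : ℕ} (μ ν α β : Fin n) : PolyP n → PolyP n := fun p =>
  ∑ᶠ k : ℕ, bcoef k • Dpow k μ ν α β p

/-- `ψ(K̃)` on the pair-single block. -/
noncomputable def psiLL {n : ℕ} (μ ν α : Fin n) : PolyP n → PolyP n := fun p =>
  ∑ᶠ k : ℕ, bcoef k • LLpow k μ ν α p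

/-- `P̂_μ = Σ_{α,α'} p_α η_{αα'} ∘ ψ(K̃)_{μα'}`. -/
noncomputable def Phat {n : ℕ} (μ : Fin n) : PolyP n → PolyP n := fun p =>
  ∑ α, ∑ α', etaM α α' • (pvar α * psiA μ α' p)

/-- `M̂_{μν} = Σ x_{αβ} η_{αα'} η_{ββ'} ∘ ψ(K̃)_{(μν)(α'β')} + Σ p_α η_{αα'} ∘ ψ(K̃)_{(μν)α'}`. -/
noncomputable def Mhat {n : ℕ} (μ ν : Fin n) : PolyP n → PolyP n := fun p =>
  (∑ α, ∑ β, ∑ α', ∑ β', (etaM α α' * etaM β β') • (xv α β * psiD μ ν α' β' p))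
    + ∑ α, ∑ α', etaM α α' • (pvar α * psiLL μ ν α' p)

/-- `η`-contracted matrix powers of `∂ = [∂_{μν}]`: `(∂⁰)_{μν} = η_{μν}`,
`(∂^m)_{μν} = Σ_{α,β}(∂^{m-1})_{μα} η_{αβ} ∂_{βν}`. -/
noncomputable def dmatpowL {n : ℕ} : ℕ → Fin n → Fin n → (PolyP n → PolyP n)
  | 0 => fun μ ν p => etaM μ ν • p
  | m+1 => fun μ ν p => ∑ α, ∑ β, etaM α β • dmatpowL m μ α (dpair β ν p)

/-- The quantum angles `Λ̂_{μν} = (e^∂)_{μν} = Σ_{m≥0}(1/m!)(∂^m)_{μν}`. -/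
noncomputable def Lhat {n : ℕ} (μ ν : Fin n) : PolyP n → PolyP n := fun p =>
  ∑ᶠ m : ℕ, ((m.factorial : ℝ))⁻¹ • dmatpowL m μ ν p

section BernoulliIdentity

open Finset
open scoped Nat

/-- The degree `m` part of `(x - y) / (e ^ (x - y) - 1) * ((e ^ x - e ^ y) / (x - y)) = e ^ y`. -/
theorem bernoulli_mul_geom_sum₂_of_isDomain {A : Type*} [CommRing A] [IsDomain A] [Algebra ℚ A]
    (x y : A) (hxy : x ≠ y) (m : ℕ) :
    ∑ q ∈ antidiagonal (m + 1), algebraMap ℚ A (bernoulli q.1 / q.1 !) * (x - y) ^ q.1 *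
      (algebraMap ℚ A (q.2 ! : ℚ)⁻¹ * ∑ i ∈ range q.2, x ^ i * y ^ (q.2 - 1 - i))
      = algebraMap ℚ A (m ! : ℚ)⁻¹ * y ^ m := by
  have h : PowerSeries.rescale (x - y) (bernoulliPowerSeries A) *
      (PowerSeries.rescale x (PowerSeries.exp A) - PowerSeries.rescale y (PowerSeries.exp A)) =
      PowerSeries.C (x - y) *
        (PowerSeries.X * PowerSeries.rescale y (PowerSeries.exp A)) := by
    have h1 := congrArg (PowerSeries.rescale (x - y)) (bernoulliPowerSeries_mul_exp_sub_one A)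
    rw [map_mul, map_sub, map_one, PowerSeries.rescale_X] at h1
    have h2 : PowerSeries.rescale x (PowerSeries.exp A) =
        PowerSeries.rescale (x - y) (PowerSeries.exp A) *
          PowerSeries.rescale y (PowerSeries.exp A) := by
      rw [PowerSeries.exp_mul_exp_eq_exp_add, sub_add_cancel]
    rw [h2, ← mul_assoc, ← h1]
    ring
  have h3 := congrArg (PowerSeries.coeff (m + 1)) h
  rw [PowerSeries.coeff_mul, PowerSeries.coeff_C_mul, PowerSeries.coeff_succ_X_mul] at h3
  simp only [PowerSeries.coeff_rescale, map_sub, PowerSeries.coeff_exp, bernoulliPowerSeries,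
    PowerSeries.coeff_mk, one_div] at h3
  apply mul_right_cancel₀ (sub_ne_zero.2 hxy)
  rw [sum_mul, mul_comm _ (x - y), mul_comm (algebraMap ℚ A _) (y ^ m), ← h3]
  refine sum_congr rfl fun q _ => ?_
  rw [mul_assoc, mul_assoc, mul_assoc, geom_sum₂_mul]
  ring

theorem Commute.bernoulli_mul_geom_sum₂ {E : Type*} [Ring E] [Algebra ℝ E] {x y : E}
    (hxy : Commute x y) (m : ℕ) :
    ∑ q ∈ antidiagonal (m + 1), (((bernoulli q.1 : ℚ) : ℝ) / q.1 ! * (q.2 ! : ℝ)⁻¹) •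
      ((x - y) ^ q.1 * ∑ i ∈ range q.2, x ^ i * y ^ (q.2 - 1 - i)) = (m ! : ℝ)⁻¹ • y ^ m := by
  let f : Polynomial ℝ →ₐ[ℝ] E := Polynomial.aeval y
  have hf : ∀ r, Commute (f r) x := fun r => by
    induction r using Polynomial.induction_on' with
    | add p q hp hq => rw [map_add]; exact hp.add_left hq
    | monomial k c =>
      simp only [f, Polynomial.aeval_monomial]
      exact (Algebra.commute_algebraMap_left c x).mul_left (hxy.symm.pow_left k)
  let g : Polynomial (Polynomial ℝ) →+* E := Polynomial.eval₂RingHom' f.toRingHom x hf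
  have hX : g Polynomial.X = x := by simp [g]
  have hY : g (Polynomial.C Polynomial.X) = y := by simp [g, f]
  have hq : ∀ c : ℚ, g (algebraMap ℚ _ c) = algebraMap ℝ E c := fun c => by
    have : algebraMap ℚ (Polynomial (Polynomial ℝ)) c = Polynomial.C (Polynomial.C (c : ℝ)) := by
      rw [Polynomial.algebraMap_apply, Polynomial.algebraMap_apply]; rfl
    rw [this]
    simp [g, f]
  have := congrArg g (bernoulli_mul_geom_sum₂_of_isDomain
    (Polynomial.X : Polynomial (Polynomial ℝ)) (Polynomial.C Polynomial.X)
    (Polynomial.X_ne_C _) m)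
  simp only [map_sum, map_mul, map_pow, map_sub, hX, hY, hq] at this
  push_cast at this
  rw [Algebra.smul_def, ← this]
  refine sum_congr rfl fun q _ => ?_
  rw [Algebra.smul_def, map_mul, mul_assoc, mul_assoc, ← mul_assoc (algebraMap ℝ E _) (_ ^ _),
    ← mul_assoc (_ ^ _), (Algebra.commute_algebraMap_left _ ((x - y) ^ q.1)).eq]

/-- Commuting with a power, expanded by the Leibniz rule. -/
theorem mul_pow_sub_pow_mul {E : Type*} [Ring E] (y a : E) (j : ℕ) :
    y * a ^ j - a ^ j * y =
      ∑ i ∈ range j, a ^ i * (y * a - a * y) * a ^ (j - 1 - i) := by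
  induction j with
  | zero => simp
  | succ j ih =>
    have h : y * a ^ (j + 1) - a ^ (j + 1) * y =
        (y * a ^ j - a ^ j * y) * a + a ^ j * (y * a - a * y) := by
      rw [pow_succ]; noncomm_ring
    rw [h, ih, sum_range_succ, sum_mul]
    simp only [add_tsub_cancel_right, tsub_self, pow_zero, mul_one]
    congr 1
    refine sum_congr rfl fun i hi => ?_
    have : j - i = j - 1 - i + 1 := by have := mem_range.1 hi; omega
    rw [this, pow_succ]
    simp only [mul_assoc]

end BernoulliIdentity

section DegreeFiltration

variable {σ : Type*}

/-- Polynomials all of whose monomials have degree at most `z`. -/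
def degreeLE (σ : Type*) (z : ℤ) : Submodule ℝ (MvPolynomial σ ℝ) where
  carrier := {p | ∀ m : σ →₀ ℕ, z < m.degree → p.coeff m = 0}
  add_mem' hp hq m hm := by rw [coeff_add, hp m hm, hq m hm, add_zero]
  zero_mem' m _ := coeff_zero m
  smul_mem' c p hp m hm := by rw [coeff_smul, hp m hm, smul_zero]

theorem degreeLE_mono {y z : ℤ} (h : y ≤ z) : degreeLE σ y ≤ degreeLE σ z :=
  fun _ hp m hm => hp m (h.trans_lt hm)

theorem eq_zero_of_mem_degreeLE {z : ℤ} (hz : z < 0) {p : MvPolynomial σ ℝ}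
    (hp : p ∈ degreeLE σ z) : p = 0 := by
  ext m
  exact hp m (by omega)

theorem mem_degreeLE_totalDegree (p : MvPolynomial σ ℝ) : p ∈ degreeLE σ p.totalDegree :=
  fun _ hm => coeff_eq_zero_of_totalDegree_lt (by exact_mod_cast hm)

/-- Operators that lower the degree by at least `d`. -/
def lowering (σ : Type*) (d : ℤ) : Submodule ℝ (Module.End ℝ (MvPolynomial σ ℝ)) where
  carrier := {T | ∀ z : ℤ, ∀ p ∈ degreeLE σ z, T p ∈ degreeLE σ (z - d)}
  add_mem' hS hT z p hp := add_mem (hS z p hp) (hT z p hp)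
  zero_mem' _ _ _ := zero_mem _
  smul_mem' c _ hT z p hp := Submodule.smul_mem _ c (hT z p hp)

theorem lowering_anti {d e : ℤ} (h : e ≤ d) : lowering σ d ≤ lowering σ e :=
  fun _ hT z p hp => degreeLE_mono (by omega) (hT z p hp)

theorem mul_mem_lowering {d e : ℤ} {S T : Module.End ℝ (MvPolynomial σ ℝ)}
    (hS : S ∈ lowering σ d) (hT : T ∈ lowering σ e) : S * T ∈ lowering σ (d + e) :=
  fun z p hp => by
    have := hS _ _ (hT z p hp)
    rwa [sub_sub, add_comm e d] at this

theorem one_mem_lowering : (1 : Module.End ℝ (MvPolynomial σ ℝ)) ∈ lowering σ 0 :=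
  fun z p hp => by simpa using hp

theorem pderiv_mem_lowering (i : σ) :
    (pderiv i : Derivation ℝ (MvPolynomial σ ℝ) (MvPolynomial σ ℝ)).toLinearMap
      ∈ lowering σ 1 := fun z p hp m hm => by
  rw [Derivation.coeFn_coe, coeff_pderiv, hp, zero_mul]
  rw [map_add, Finsupp.degree_single]
  push_cast
  omega

theorem mulLeft_X_mem_lowering (i : σ) :
    LinearMap.mulLeft ℝ (X i : MvPolynomial σ ℝ) ∈ lowering σ (-1) := fun z p hp m hm => by
  classical
  rw [LinearMap.mulLeft_apply, coeff_X_mul']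
  split_ifs with hi
  · apply hp
    have h : Finsupp.single i 1 ≤ m := by
      rw [Finsupp.single_le_iff]
      exact Nat.one_le_iff_ne_zero.2 (Finsupp.mem_support_iff.1 hi)
    have h' := congrArg Finsupp.degree (tsub_add_cancel_of_le h)
    rw [map_add, Finsupp.degree_single] at h'
    omega
  · rfl

/-- Constant-coefficient differential operators that lower the degree by at least `d`. -/
noncomputable def diffOps (σ : Type*) (d : ℤ) :
    Submodule ℝ (Module.End ℝ (MvPolynomial σ ℝ)) :=
  lowering σ d ⊓ Subalgebra.toSubmodule (Algebra.adjoin ℝ (Set.range fun i : σ =>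
    (pderiv i : Derivation ℝ (MvPolynomial σ ℝ) (MvPolynomial σ ℝ)).toLinearMap))

theorem pderiv_mem_diffOps (i : σ) :
    (pderiv i : Derivation ℝ (MvPolynomial σ ℝ) (MvPolynomial σ ℝ)).toLinearMap
      ∈ diffOps σ 1 :=
  ⟨pderiv_mem_lowering i, Algebra.subset_adjoin ⟨i, rfl⟩⟩

theorem one_mem_diffOps : (1 : Module.End ℝ (MvPolynomial σ ℝ)) ∈ diffOps σ 0 :=
  ⟨one_mem_lowering, one_mem (Algebra.adjoin ℝ _)⟩

theorem mul_mem_diffOps {d e : ℤ} {S T : Module.End ℝ (MvPolynomial σ ℝ)}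
    (hS : S ∈ diffOps σ d) (hT : T ∈ diffOps σ e) : S * T ∈ diffOps σ (d + e) :=
  ⟨mul_mem_lowering hS.1 hT.1, mul_mem (S := Subalgebra ℝ _) hS.2 hT.2⟩

theorem commute_pderiv (i j : σ) :
    Commute (pderiv i : Derivation ℝ (MvPolynomial σ ℝ) (MvPolynomial σ ℝ)).toLinearMap
      (pderiv j : Derivation ℝ (MvPolynomial σ ℝ) (MvPolynomial σ ℝ)).toLinearMap := by
  classical
  have h : ⁅(pderiv i : Derivation ℝ (MvPolynomial σ ℝ) (MvPolynomial σ ℝ)),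
      (pderiv j : Derivation ℝ (MvPolynomial σ ℝ) (MvPolynomial σ ℝ))⁆ = 0 := by
    refine MvPolynomial.derivation_ext fun k => ?_
    simp [Derivation.commutator_apply, pderiv_X, Pi.single_apply, apply_ite]
  refine LinearMap.ext fun p => sub_eq_zero.1 ?_
  exact congrArg (fun D : Derivation ℝ (MvPolynomial σ ℝ) (MvPolynomial σ ℝ) => D p) h

theorem commute_of_mem_diffOps {d e : ℤ} {S T : Module.End ℝ (MvPolynomial σ ℝ)}
    (hS : S ∈ diffOps σ d) (hT : T ∈ diffOps σ e) : Commute S T := by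
  refine Algebra.commute_of_mem_adjoin_of_forall_mem_commute (R := ℝ) hT.2 ?_
  rintro _ ⟨i, rfl⟩
  refine (Algebra.commute_of_mem_adjoin_of_forall_mem_commute (R := ℝ) hS.2 ?_).symm
  rintro _ ⟨j, rfl⟩
  exact commute_pderiv i j

end DegreeFiltration

section OperatorSeries

open Finset

variable {σ : Type*}

/-- `U` is the sum of the locally finite series of operators `u`, whose `k`-th term
lowers the degree by at least `k - 1`. -/
structure IsOpSeries (U : MvPolynomial σ ℝ → MvPolynomial σ ℝ)
    (u : ℕ → Module.End ℝ (MvPolynomial σ ℝ)) : Prop where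
  mem_lowering (k : ℕ) : u k ∈ lowering σ (k - 1)
  eq_sum (z : ℤ) (p : MvPolynomial σ ℝ) (hp : p ∈ degreeLE σ z) (K : ℕ) (hK : z < K) :
    U p = ∑ k ∈ range K, u k p

theorem finsum_eq_sum_range_of_mem_lowering {u : ℕ → Module.End ℝ (MvPolynomial σ ℝ)}
    (hu : ∀ k : ℕ, u k ∈ lowering σ k) {z : ℤ} {p : MvPolynomial σ ℝ} (hp : p ∈ degreeLE σ z)
    {K : ℕ} (hK : z < K) : ∑ᶠ k, u k p = ∑ k ∈ range K, u k p := by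
  refine finsum_eq_sum_of_support_subset _ fun k hk => ?_
  by_contra h
  rw [coe_range, Set.mem_Iio, not_lt] at h
  exact hk (eq_zero_of_mem_degreeLE (by omega) (hu k z p hp))

theorem IsOpSeries.sub {U V : MvPolynomial σ ℝ → MvPolynomial σ ℝ}
    {u v : ℕ → Module.End ℝ (MvPolynomial σ ℝ)} (hU : IsOpSeries U u) (hV : IsOpSeries V v) :
    IsOpSeries (U - V) (u - v) where
  mem_lowering k := sub_mem (hU.mem_lowering k) (hV.mem_lowering k)
  eq_sum z p hp K hK := by
    simp [hU.eq_sum z p hp K hK, hV.eq_sum z p hp K hK, sum_sub_distrib]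

theorem IsOpSeries.smul {U : MvPolynomial σ ℝ → MvPolynomial σ ℝ}
    {u : ℕ → Module.End ℝ (MvPolynomial σ ℝ)} (hU : IsOpSeries U u) (c : ℝ) :
    IsOpSeries (c • U) (c • u) where
  mem_lowering k := Submodule.smul_mem _ c (hU.mem_lowering k)
  eq_sum z p hp K hK := by
    simp [hU.eq_sum z p hp K hK, smul_sum]

theorem isOpSeries_zero : IsOpSeries (0 : MvPolynomial σ ℝ → MvPolynomial σ ℝ) 0 where
  mem_lowering _ := zero_mem _
  eq_sum _ _ _ _ _ := by simp

theorem IsOpSeries.mem_degreeLE {U : MvPolynomial σ ℝ → MvPolynomial σ ℝ}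
    {u : ℕ → Module.End ℝ (MvPolynomial σ ℝ)} (hU : IsOpSeries U u) {z : ℤ}
    {p : MvPolynomial σ ℝ} (hp : p ∈ degreeLE σ z) : U p ∈ degreeLE σ (z + 1) := by
  rw [hU.eq_sum z p hp (z.toNat + 1) (by omega)]
  exact sum_mem fun k _ => degreeLE_mono (by omega) (hU.mem_lowering k z p hp)

theorem sum_range_product_eq_sum_antidiagonal {M : Type*} [AddCommMonoid M] (f : ℕ × ℕ → M)
    (K : ℕ) (hf : ∀ q, K ≤ q.1 + q.2 → f q = 0) :
    ∑ k ∈ range K, ∑ j ∈ range K, f (k, j) = ∑ s ∈ range K, ∑ q ∈ antidiagonal s, f q := by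
  rw [← sum_product', sum_sigma']
  refine (sum_subset_zero_on_sdiff (s₁ := (range K ×ˢ range K).filter fun q => q.1 + q.2 < K)
    (filter_subset _ _) ?_ fun _ _ => rfl).symm.trans ?_
  · intro q hq
    apply hf
    simp only [mem_sdiff, mem_filter, not_and, not_lt] at hq
    exact hq.2 hq.1
  · refine sum_nbij' (fun q => ⟨q.1 + q.2, q⟩) (fun x => x.2) ?_ ?_ ?_ ?_ ?_
    · rintro ⟨k, j⟩ h
      simp at h ⊢
      omega
    · rintro ⟨s, k, j⟩ h
      simp at h ⊢
      omega
    · simp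
    · rintro ⟨s, k, j⟩ h
      simp at h ⊢
      exact h.2
    · simp

/-- Commutators of operator series may be computed order by order. -/
theorem IsOpSeries.commutator_eq {U V W : MvPolynomial σ ℝ → MvPolynomial σ ℝ}
    {u v w : ℕ → Module.End ℝ (MvPolynomial σ ℝ)} (hU : IsOpSeries U u) (hV : IsOpSeries V v)
    (hW : IsOpSeries W w)
    (hlow : ∀ k j : ℕ, u k * v j - v j * u k ∈ lowering σ (k + j - 1))
    (h0 : u 0 * v 0 - v 0 * u 0 = 0)
    (h : ∀ m, ∑ q ∈ antidiagonal (m + 1), (u q.1 * v q.2 - v q.2 * u q.1) = w m) :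
    U ∘ V - V ∘ U = W := by
  funext p
  have hp := mem_degreeLE_totalDegree p
  set z : ℤ := (p.totalDegree : ℤ) with hz
  set K : ℕ := p.totalDegree + 2 with hK
  have key : ∀ {S T : MvPolynomial σ ℝ → MvPolynomial σ ℝ}
      {s t : ℕ → Module.End ℝ (MvPolynomial σ ℝ)}, IsOpSeries S s → IsOpSeries T t →
      S (T p) = ∑ k ∈ range K, ∑ j ∈ range K, (s k * t j) p := fun hS hT => by
    rw [hS.eq_sum (z + 1) _ (hT.mem_degreeLE hp) K (by omega), hT.eq_sum z p hp K (by omega)]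
    simp only [map_sum, Module.End.mul_apply]
  have hc : (U ∘ V - V ∘ U) p =
      ∑ k ∈ range K, ∑ j ∈ range K, (u k * v j - v j * u k) p := by
    rw [Pi.sub_apply, Function.comp_apply, Function.comp_apply, key hU hV, key hV hU,
      sum_comm (f := fun k j => (v k * u j) p), ← sum_sub_distrib]
    refine sum_congr rfl fun k _ => ?_
    rw [← sum_sub_distrib]
    rfl
  rw [hc, sum_range_product_eq_sum_antidiagonal
    (fun q => (u q.1 * v q.2 - v q.2 * u q.1) p) K, hW.eq_sum z p hp (p.totalDegree + 1) (by omega),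
    hK, sum_range_succ']
  · simp only [← h, Nat.antidiagonal_zero, sum_singleton, h0, LinearMap.zero_apply, add_zero,
      LinearMap.sum_apply]
  · intro q hq
    exact eq_zero_of_mem_degreeLE (by omega) (hlow q.1 q.2 z p hp)

end OperatorSeries

section PoincareOperators

open Finset
open scoped Nat

variable {n : ℕ}

theorem etaM_eq (μ ν : Fin n) : (etaM μ ν : ℝ) = if μ = ν then etaM μ μ else 0 := by
  simp only [etaM]
  split_ifs <;> rfl

theorem etaM_comm (μ ν : Fin n) : (etaM μ ν : ℝ) = etaM ν μ := by
  rw [etaM_eq μ, etaM_eq ν]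
  by_cases h : μ = ν
  · subst h; rfl
  · rw [if_neg h, if_neg (Ne.symm h)]

theorem etaM_self_mul_self (μ : Fin n) : (etaM μ μ : ℝ) * etaM μ μ = 1 := by
  simp only [etaM]
  split_ifs <;> norm_num

theorem sum_etaM_smul {M : Type*} [AddCommGroup M] [Module ℝ M] (α : Fin n) (f : Fin n → M) :
    ∑ β, etaM α β • f β = etaM α α • f α := by
  rw [sum_eq_single α]
  · intro β _ h
    rw [etaM_eq, if_neg h.symm, zero_smul]
  · simp

theorem sum_etaM_mul_etaM_smul {M : Type*} [AddCommGroup M] [Module ℝ M] (α β : Fin n)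
    (f : Fin n → Fin n → M) :
    ∑ γ, ∑ δ, (etaM α γ * etaM β δ) • f γ δ = (etaM α α * etaM β β) • f α β := by
  simp only [mul_smul, ← smul_sum, sum_etaM_smul]

section PairBlocks

variable {E : Type*} [Ring E] [Algebra ℝ E] (A : Fin n → Fin n → E)

/-- The matrix `A η`. -/
def pairMatrix : Matrix (Fin n) (Fin n) E := Matrix.of fun μ ν => (etaM ν ν : ℝ) • A μ ν

theorem pairMatrix_apply (μ ν : Fin n) : pairMatrix A μ ν = (etaM ν ν : ℝ) • A μ ν := rfl

/-- The block `D_{(μν)(αβ)}` built from `A`. -/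
noncomputable def pairBlock (μ ν α β : Fin n) : E :=
  (1 / 2 : ℝ) • ((etaM μ α : ℝ) • A ν β - (etaM μ β : ℝ) • A ν α
    + (etaM ν β : ℝ) • A μ α - (etaM ν α : ℝ) • A μ β)

/-- The entries `(D^m)_{(μν)(αβ)}` of the `η`-contracted powers of `pairBlock`. -/
noncomputable def pairBlockPow : ℕ → Fin n → Fin n → Fin n → Fin n → E
  | 0 => fun μ ν α β => ((1 / 2 : ℝ) * (etaM μ α * etaM ν β - etaM μ β * etaM ν α)) • 1
  | m + 1 => fun μ ν α β => ∑ κ, ∑ ρ,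
      (etaM κ κ * etaM ρ ρ : ℝ) • (pairBlock A μ ν κ ρ * pairBlockPow m κ ρ α β)

/-- The matrix `(D^m)_{(μν)} η` for fixed `μ`, `ν`. -/
noncomputable def pairBlockMatrix (m : ℕ) (μ ν : Fin n) : Matrix (Fin n) (Fin n) E :=
  pairMatrix fun α β => pairBlockPow A m μ ν α β

theorem pairBlock_swap (μ ν α β : Fin n) : pairBlock A μ ν β α = -pairBlock A μ ν α β := by
  unfold pairBlock
  module

theorem pairBlockPow_zero (μ ν α β : Fin n) : pairBlockPow A 0 μ ν α β =
    ((1 / 2 : ℝ) * (etaM μ α * etaM ν β - etaM μ β * etaM ν α)) • 1 := rfl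

theorem pairBlockPow_succ (m : ℕ) (μ ν α β : Fin n) : pairBlockPow A (m + 1) μ ν α β =
    ∑ κ, ∑ ρ, (etaM κ κ * etaM ρ ρ : ℝ) •
      (pairBlock A μ ν κ ρ * pairBlockPow A m κ ρ α β) := rfl

theorem pairBlockPow_swap (m : ℕ) (μ ν α β : Fin n) :
    pairBlockPow A m μ ν β α = -pairBlockPow A m μ ν α β := by
  induction m generalizing μ ν with
  | zero =>
    rw [pairBlockPow_zero, pairBlockPow_zero]
    module
  | succ m ih =>
    simp only [pairBlockPow_succ, ih, mul_neg, smul_neg, sum_neg_distrib]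

theorem pairBlockPow_one (μ ν α β : Fin n) :
    pairBlockPow A 1 μ ν α β = pairBlock A μ ν α β := by
  have h : ∀ κ ρ : Fin n, (etaM κ κ * etaM ρ ρ : ℝ) •
      (pairBlock A μ ν κ ρ * pairBlockPow A 0 κ ρ α β) =
      (1 / 2 : ℝ) • ((etaM α κ * etaM β ρ : ℝ) •
        ((etaM κ κ * etaM ρ ρ : ℝ) • pairBlock A μ ν κ ρ)) -
      (1 / 2 : ℝ) • ((etaM β κ * etaM α ρ : ℝ) •
        ((etaM κ κ * etaM ρ ρ : ℝ) • pairBlock A μ ν κ ρ)) := fun κ ρ => by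
    rw [pairBlockPow_zero, mul_smul_comm, mul_one, etaM_comm α κ, etaM_comm β ρ, etaM_comm β κ,
      etaM_comm α ρ]
    module
  simp only [pairBlockPow_succ, h, sum_sub_distrib, ← smul_sum, sum_etaM_mul_etaM_smul]
  rw [pairBlock_swap A μ ν α β]
  have hαβ : (etaM α α * etaM β β * (etaM α α * etaM β β) : ℝ) = 1 := by
    rw [mul_mul_mul_comm, etaM_self_mul_self, etaM_self_mul_self, one_mul]
  rw [mul_comm (etaM β β : ℝ), smul_smul (etaM α α * etaM β β : ℝ),
    smul_smul (etaM α α * etaM β β : ℝ), hαβ]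
  module

variable {A}

theorem commute_pairBlock (hcomm : ∀ μ ν α β, Commute (A μ ν) (A α β))
    (μ ν κ ρ α β : Fin n) : Commute (A μ ν) (pairBlock A κ ρ α β) := by
  unfold pairBlock
  exact (((((hcomm _ _ _ _).smul_right _).sub_right ((hcomm _ _ _ _).smul_right _)).add_right
    ((hcomm _ _ _ _).smul_right _)).sub_right ((hcomm _ _ _ _).smul_right _)).smul_right _

theorem commute_pairBlockPow (hcomm : ∀ μ ν α β, Commute (A μ ν) (A α β))
    (m : ℕ) (μ ν κ ρ α β : Fin n) : Commute (A μ ν) (pairBlockPow A m κ ρ α β) := by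
  induction m generalizing κ ρ with
  | zero => exact (Commute.one_right _).smul_right _
  | succ m ih =>
    rw [pairBlockPow_succ]
    exact Commute.sum_right _ _ _ fun _ _ => Commute.sum_right _ _ _ fun _ _ =>
      ((commute_pairBlock hcomm _ _ _ _ _ _).mul_right (ih _ _)).smul_right _

theorem pairBlockMatrix_zero_mul (μ ν : Fin n) (B : Matrix (Fin n) (Fin n) E) (α β : Fin n) :
    (pairBlockMatrix A 0 μ ν * B) α β =
      (1 / 2 : ℝ) • ((etaM μ α : ℝ) • B ν β - (etaM ν α : ℝ) • B μ β) := by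
  have h : ∀ κ, pairBlockMatrix A 0 μ ν α κ * B κ β =
      (1 / 2 * etaM μ α : ℝ) • ((etaM ν κ : ℝ) • ((etaM κ κ : ℝ) • B κ β)) -
      (1 / 2 * etaM ν α : ℝ) • ((etaM μ κ : ℝ) • ((etaM κ κ : ℝ) • B κ β)) := fun κ => by
    rw [pairBlockMatrix, pairMatrix_apply, pairBlockPow_zero, smul_mul_assoc, smul_mul_assoc,
      one_mul]
    module
  rw [Matrix.mul_apply]
  simp only [h, sum_sub_distrib, ← smul_sum, sum_etaM_smul]
  rw [smul_smul (etaM ν ν : ℝ), smul_smul (etaM μ μ : ℝ), etaM_self_mul_self, etaM_self_mul_self]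
  module

theorem pairBlockMatrix_succ (hA : ∀ μ ν, A ν μ = -A μ ν)
    (hcomm : ∀ μ ν α β, Commute (A μ ν) (A α β)) (m : ℕ) (μ ν : Fin n) :
    pairBlockMatrix A (m + 1) μ ν =
      pairBlockMatrix A m μ ν * pairMatrix A - pairMatrix A * pairBlockMatrix A m μ ν := by
  induction m generalizing μ ν with
  | zero =>
    ext α β
    have h : ∀ κ, pairMatrix A α κ * pairBlockMatrix A 0 μ ν κ β =
        (1 / 2 * etaM β β * etaM ν β : ℝ) • ((etaM μ κ : ℝ) • ((etaM κ κ : ℝ) • A α κ)) -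
        (1 / 2 * etaM β β * etaM μ β : ℝ) •
          ((etaM ν κ : ℝ) • ((etaM κ κ : ℝ) • A α κ)) := fun κ => by
      rw [pairBlockMatrix, pairMatrix_apply, pairMatrix_apply, pairBlockPow_zero, mul_smul_comm,
        mul_smul_comm, mul_one]
      module
    rw [Matrix.sub_apply, pairBlockMatrix_zero_mul, Matrix.mul_apply]
    simp only [h, sum_sub_distrib, ← smul_sum, sum_etaM_smul]
    rw [smul_smul (etaM ν ν : ℝ), smul_smul (etaM μ μ : ℝ), etaM_self_mul_self,
      etaM_self_mul_self, pairBlockMatrix, pairMatrix_apply, zero_add, pairBlockPow_one, pairBlock,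
      pairMatrix_apply, pairMatrix_apply, hA μ α, hA ν α]
    module
  | succ m ih =>
    have h : ∀ m, pairBlockMatrix A (m + 1) μ ν = ∑ κ, ∑ ρ, (etaM κ κ * etaM ρ ρ : ℝ) •
        (pairBlock A μ ν κ ρ • pairBlockMatrix A m κ ρ) := fun m => by
      ext α β
      simp only [Matrix.sum_apply, Matrix.smul_apply, pairBlockMatrix, pairMatrix_apply,
        pairBlockPow_succ, smul_sum, smul_eq_mul, mul_smul_comm]
      refine sum_congr rfl fun κ _ => sum_congr rfl fun ρ _ => ?_
      rw [smul_comm]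
    rw [h (m + 1), h m]
    simp only [sum_mul, mul_sum, ← sum_sub_distrib]
    refine sum_congr rfl fun κ _ => sum_congr rfl fun ρ _ => ?_
    rw [ih, smul_mul_assoc, mul_smul_comm, ← smul_sub, smul_sub, smul_mul_assoc]
    congr 2
    ext α β
    simp only [Matrix.mul_apply, Matrix.smul_apply, smul_eq_mul, mul_sum]
    refine sum_congr rfl fun γ _ => ?_
    rw [← mul_assoc, ← mul_assoc, pairMatrix_apply,
      ((commute_pairBlock hcomm α γ μ ν κ ρ).smul_left _).eq]

theorem pairBlockMatrix_eq_pow (hA : ∀ μ ν, A ν μ = -A μ ν)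
    (hcomm : ∀ μ ν α β, Commute (A μ ν) (A α β)) (m : ℕ) (μ ν : Fin n) :
    pairBlockMatrix A m μ ν =
      ((-1 : ℝ) ^ m) • (((LinearMap.mulLeft ℝ (pairMatrix A) -
        LinearMap.mulRight ℝ (pairMatrix A)) ^ m) (pairBlockMatrix A 0 μ ν)) := by
  induction m with
  | zero => simp
  | succ m ih =>
    rw [pairBlockMatrix_succ hA hcomm, ih, pow_succ' (_ - _), Module.End.mul_apply,
      LinearMap.sub_apply, LinearMap.mulLeft_apply, LinearMap.mulRight_apply, pow_succ,
      smul_mul_assoc, mul_smul_comm]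
    module

/-- Degree `k` part of the commutator of `x · D^k` with the entries of `A η`. -/
theorem commutator_pairMatrix {x : Fin n → Fin n → E}
    (hcomm : ∀ μ ν α β, Commute (A μ ν) (A α β))
    (hx : ∀ γ δ α β, A γ δ * x α β - x α β * A γ δ =
      (etaM γ α * etaM δ β - etaM γ β * etaM δ α : ℝ) • 1)
    {z : E} (hz : ∀ γ δ, Commute (A γ δ) z) (k : ℕ) (μ ν γ δ : Fin n) :
    (∑ α, ∑ β, (etaM α α * etaM β β : ℝ) • (x α β * pairBlockPow A k μ ν α β) + z) *
        pairMatrix A γ δ -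
      pairMatrix A γ δ *
        (∑ α, ∑ β, (etaM α α * etaM β β : ℝ) • (x α β * pairBlockPow A k μ ν α β) + z) =
      ((-2 : ℝ) • pairBlockMatrix A k μ ν) γ δ := by
  have h : ∀ α β, (etaM α α * etaM β β : ℝ) • (x α β * pairBlockPow A k μ ν α β) * A γ δ -
      A γ δ * (etaM α α * etaM β β : ℝ) • (x α β * pairBlockPow A k μ ν α β) =
      (etaM δ α * etaM γ β : ℝ) • ((etaM α α * etaM β β : ℝ) • pairBlockPow A k μ ν α β) -
      (etaM γ α * etaM δ β : ℝ) • ((etaM α α * etaM β β : ℝ) • pairBlockPow A k μ ν α β) :=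
    fun α β => by
    have h1 : x α β * pairBlockPow A k μ ν α β * A γ δ - A γ δ * (x α β * pairBlockPow A k μ ν α β)
        = -((etaM γ α * etaM δ β - etaM γ β * etaM δ α : ℝ) • pairBlockPow A k μ ν α β) := by
      rw [mul_assoc, ← (commute_pairBlockPow hcomm k γ δ μ ν α β).eq, ← mul_assoc, ← mul_assoc,
        ← sub_mul, ← neg_sub, hx, neg_mul, smul_mul_assoc, one_mul]
    rw [smul_mul_assoc, mul_smul_comm, ← smul_sub, h1]
    module
  have hsq : (etaM γ γ * etaM δ δ * (etaM γ γ * etaM δ δ) : ℝ) = 1 := by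
    rw [mul_mul_mul_comm, etaM_self_mul_self, etaM_self_mul_self, one_mul]
  rw [pairMatrix_apply, mul_smul_comm, smul_mul_assoc, ← smul_sub, add_mul, mul_add,
    (hz γ δ).eq, add_sub_add_right_eq_sub]
  simp only [sum_mul, mul_sum, ← sum_sub_distrib, h]
  simp only [sum_sub_distrib, sum_etaM_mul_etaM_smul]
  rw [pairBlockPow_swap A k μ ν γ δ, mul_comm (etaM δ δ : ℝ), smul_smul (etaM γ γ * etaM δ δ : ℝ),
    smul_smul (etaM γ γ * etaM δ δ : ℝ), hsq, Matrix.smul_apply, pairBlockMatrix, pairMatrix_apply]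
  module

/-- Order `m` part of the relation `[M, Λ] = η Λ - η Λ`. -/
theorem sum_antidiagonal_commutator (hA : ∀ μ ν, A ν μ = -A μ ν) {x : Fin n → Fin n → E}
    (hcomm : ∀ μ ν α β, Commute (A μ ν) (A α β))
    (hx : ∀ γ δ α β, A γ δ * x α β - x α β * A γ δ =
      (etaM γ α * etaM δ β - etaM γ β * etaM δ α : ℝ) • 1)
    {z : ℕ → E} (hz : ∀ k γ δ, Commute (A γ δ) (z k)) (μ ν : Fin n) {y : ℕ → E}
    (hy : ∀ k, y k = ∑ α, ∑ β, (etaM α α * etaM β β : ℝ) •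
      (x α β * pairBlockPow A k μ ν α β) + z k) (m : ℕ) (ρ σ : Fin n) :
    ∑ q ∈ antidiagonal (m + 1), (bcoef q.1 * (q.2 ! : ℝ)⁻¹) •
        (y q.1 * (pairMatrix A ^ q.2) ρ σ - (pairMatrix A ^ q.2) ρ σ * y q.1) =
      (m ! : ℝ)⁻¹ • ((etaM ν ρ : ℝ) • (pairMatrix A ^ m) μ σ -
        (etaM μ ρ : ℝ) • (pairMatrix A ^ m) ν σ) := by
  set a := pairMatrix A with ha
  set L := LinearMap.mulLeft ℝ a
  set R := LinearMap.mulRight ℝ a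
  have hLR : Commute L R := LinearMap.commute_mulLeft_right a a
  have hcom : ∀ k, Matrix.diagonal (fun _ => y k) * a - a * Matrix.diagonal (fun _ => y k) =
      (-2 : ℝ) • pairBlockMatrix A k μ ν := fun k => by
    ext γ δ
    rw [Matrix.sub_apply, Matrix.diagonal_mul, Matrix.mul_diagonal, hy k]
    exact commutator_pairMatrix hcomm hx (hz k) k μ ν γ δ
  have hterm : ∀ k j, y k * (a ^ j) ρ σ - (a ^ j) ρ σ * y k =
      (((-1 : ℝ) ^ k * (-2)) • ((L - R) ^ k * ∑ i ∈ range j, L ^ i * R ^ (j - 1 - i))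
        (pairBlockMatrix A 0 μ ν)) ρ σ := fun k j => by
    have h1 : y k * (a ^ j) ρ σ - (a ^ j) ρ σ * y k = (Matrix.diagonal (fun _ => y k) * a ^ j -
        a ^ j * Matrix.diagonal (fun _ => y k) : Matrix (Fin n) (Fin n) E) ρ σ := by
      rw [Matrix.sub_apply, Matrix.diagonal_mul, Matrix.mul_diagonal]
    have h2 : Commute ((L - R) ^ k) (∑ i ∈ range j, L ^ i * R ^ (j - 1 - i)) :=
      (Commute.sum_right (range j) (fun i => L ^ i * R ^ (j - 1 - i)) (L - R) fun i _ =>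
        (((Commute.refl L).sub_left hLR.symm).pow_right i).mul_right
          ((hLR.sub_left (Commute.refl R)).pow_right _)).pow_left k
    rw [h1, mul_pow_sub_pow_mul, h2.eq, Module.End.mul_apply, LinearMap.sum_apply, smul_sum]
    refine congrFun (congrFun (sum_congr rfl fun i _ => ?_) ρ) σ
    rw [hcom, pairBlockMatrix_eq_pow hA hcomm, Module.End.mul_apply, LinearMap.pow_mulLeft,
      LinearMap.pow_mulRight, LinearMap.mulLeft_apply, LinearMap.mulRight_apply, mul_smul_comm,
      mul_smul_comm, smul_mul_assoc, smul_mul_assoc, smul_smul, mul_assoc, mul_comm (-2 : ℝ)]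
  have hfin : ∑ q ∈ antidiagonal (m + 1), (bcoef q.1 * (q.2 ! : ℝ)⁻¹) •
      (((-1 : ℝ) ^ q.1 * (-2)) •
        ((L - R) ^ q.1 * ∑ i ∈ range q.2, L ^ i * R ^ (q.2 - 1 - i))) =
      (-2 : ℝ) • ((m ! : ℝ)⁻¹ • R ^ m) := by
    rw [← hLR.bernoulli_mul_geom_sum₂ m, smul_sum]
    refine sum_congr rfl fun q _ => ?_
    rw [smul_smul, smul_smul, bcoef]
    congr 1
    have : (-1 : ℝ) ^ q.1 * (-1) ^ q.1 = 1 := by rw [← mul_pow]; simp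
    linear_combination ((bernoulli q.1 : ℚ) : ℝ) / q.1 ! * (q.2 ! : ℝ)⁻¹ * (-2) * this
  have hev := congrArg (fun f => f (pairBlockMatrix A 0 μ ν) ρ σ) hfin
  simp only [LinearMap.sum_apply, LinearMap.smul_apply, Matrix.sum_apply, Matrix.smul_apply] at hev
  simp only [hterm, Matrix.smul_apply]
  rw [hev, LinearMap.pow_mulRight, LinearMap.mulRight_apply, pairBlockMatrix_zero_mul]
  module

end PairBlocks

/-- `∂_{μν}` as a linear operator. -/
noncomputable def pairDeriv (μ ν : Fin n) : Module.End ℝ (PolyP n) :=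
  if h : μ < ν then (etaM μ μ * etaM ν ν) •
    (pderiv (Sum.inl ⟨(μ, ν), h⟩) : Derivation ℝ (PolyP n) (PolyP n)).toLinearMap
  else if h : ν < μ then - ((etaM μ μ * etaM ν ν) •
    (pderiv (Sum.inl ⟨(ν, μ), h⟩) : Derivation ℝ (PolyP n) (PolyP n)).toLinearMap) else 0

theorem pairDeriv_apply (μ ν : Fin n) (p : PolyP n) : pairDeriv μ ν p = dpair μ ν p := by
  unfold pairDeriv dpair
  split_ifs <;> rfl

theorem pairDeriv_swap (μ ν : Fin n) : pairDeriv ν μ = -pairDeriv μ ν := by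
  unfold pairDeriv
  rcases lt_trichotomy μ ν with h | rfl | h
  · simp [h, h.not_gt, mul_comm]
  · simp
  · simp [h, h.not_gt, mul_comm]

theorem pairDeriv_mem (μ ν : Fin n) : pairDeriv μ ν ∈ diffOps (PIdx n) 1 := by
  unfold pairDeriv
  split_ifs
  · exact Submodule.smul_mem _ _ (pderiv_mem_diffOps _)
  · exact neg_mem (Submodule.smul_mem _ _ (pderiv_mem_diffOps _))
  · exact zero_mem _

/-- `∂_μ` as a linear operator. -/
noncomputable def singleDeriv (μ : Fin n) : Module.End ℝ (PolyP n) :=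
  etaM μ μ • (pderiv (Sum.inr μ) : Derivation ℝ (PolyP n) (PolyP n)).toLinearMap

theorem singleDeriv_mem (μ : Fin n) : singleDeriv μ ∈ diffOps (PIdx n) 1 :=
  Submodule.smul_mem _ _ (pderiv_mem_diffOps _)

theorem xv_swap (α β : Fin n) : xv β α = -xv α β := by
  unfold xv
  rcases lt_trichotomy α β with h | rfl | h
  · simp [h, h.not_gt]
  · simp
  · simp [h, h.not_gt]

theorem mulLeft_xv_mem (α β : Fin n) :
    LinearMap.mulLeft ℝ (xv α β) ∈ lowering (PIdx n) (-1) := by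
  have h0 : LinearMap.mulLeft ℝ (0 : PolyP n) = 0 := by ext; simp
  have h1 : ∀ q : PolyP n, LinearMap.mulLeft ℝ (-q) = -LinearMap.mulLeft ℝ q := fun q => by
    ext; simp
  unfold xv
  split_ifs
  · exact mulLeft_X_mem_lowering _
  · rw [h1]
    exact neg_mem (mulLeft_X_mem_lowering _)
  · rw [h0]
    exact zero_mem _

theorem mulLeft_pvar_mem (α : Fin n) :
    LinearMap.mulLeft ℝ (pvar α) ∈ lowering (PIdx n) (-1) :=
  mulLeft_X_mem_lowering _

theorem pairDeriv_mul_mulLeft (μ ν : Fin n) (q : PolyP n) :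
    pairDeriv μ ν * LinearMap.mulLeft ℝ q - LinearMap.mulLeft ℝ q * pairDeriv μ ν =
      LinearMap.mulLeft ℝ (pairDeriv μ ν q) := by
  refine LinearMap.ext fun p => ?_
  simp only [LinearMap.sub_apply, Module.End.mul_apply, LinearMap.mulLeft_apply, pairDeriv]
  split_ifs
  · simp only [LinearMap.smul_apply, Derivation.coeFn_coe, Derivation.leibniz, smul_eq_mul,
      smul_add, mul_smul_comm, smul_mul_assoc]
    rw [add_sub_cancel_left, mul_comm p]
  · simp only [LinearMap.neg_apply, LinearMap.smul_apply, Derivation.coeFn_coe,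
      Derivation.leibniz, smul_eq_mul, smul_add, mul_smul_comm, smul_mul_assoc, mul_neg, neg_mul]
    rw [mul_comm p]
    abel
  · simp

theorem pairDeriv_pvar (μ ν α : Fin n) : pairDeriv μ ν (pvar α) = 0 := by
  unfold pairDeriv pvar
  split_ifs <;> simp [pderiv_X]

theorem pairDeriv_xv (γ δ α β : Fin n) : pairDeriv γ δ (xv α β) =
    algebraMap ℝ _ (etaM γ α * etaM δ β - etaM γ β * etaM δ α) := by
  have key : ∀ γ δ α β : Fin n, γ < δ → α < β → pairDeriv γ δ (xv α β) =
      algebraMap ℝ _ (etaM γ α * etaM δ β - etaM γ β * etaM δ α) := by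
    intro γ δ α β h h'
    have h2 : (etaM γ β : ℝ) * etaM δ α = 0 := by
      rw [etaM_eq γ, etaM_eq δ]
      split_ifs with h3 h4
      · subst h3 h4; exact absurd h h'.not_gt
      all_goals simp
    rw [h2, sub_zero, etaM_eq γ, etaM_eq δ]
    simp only [pairDeriv, xv, h, h', dif_pos, LinearMap.smul_apply, Derivation.coeFn_coe,
      pderiv_X, Pi.single_apply, Sum.inl.injEq, Subtype.mk.injEq, Prod.mk.injEq]
    by_cases h3 : γ = α <;> by_cases h4 : δ = β <;>
      simp [h3, h4, eq_comm, Algebra.smul_def]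
  have key2 : ∀ γ δ α β : Fin n, γ < δ → pairDeriv γ δ (xv α β) =
      algebraMap ℝ _ (etaM γ α * etaM δ β - etaM γ β * etaM δ α) := by
    intro γ δ α β h
    rcases lt_trichotomy α β with h' | rfl | h'
    · exact key _ _ _ _ h h'
    · have : xv α α = 0 := by simp [xv]
      rw [this, map_zero, sub_self, map_zero]
    · rw [xv_swap, map_neg, key _ _ _ _ h h', ← map_neg, neg_sub]
  rcases lt_trichotomy γ δ with h | rfl | h
  · exact key2 _ _ _ _ h
  · have : pairDeriv γ γ = 0 := by simp [pairDeriv]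
    rw [this, LinearMap.zero_apply, mul_comm (etaM γ β), sub_self, map_zero]
  · rw [pairDeriv_swap, LinearMap.neg_apply, key2 _ _ _ _ h, ← map_neg]
    congr 1
    ring

theorem commute_pairMatrix_pow {E : Type*} [Ring E] [Algebra ℝ E] {A : Fin n → Fin n → E} {c : E}
    (h : ∀ μ ν, Commute (A μ ν) c) (m : ℕ) (μ ν : Fin n) :
    Commute ((pairMatrix A ^ m) μ ν) c := by
  induction m generalizing ν with
  | zero =>
    rw [pow_zero, Matrix.one_apply]
    split_ifs
    · exact Commute.one_left _
    · exact Commute.zero_left _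
  | succ m ih =>
    rw [pow_succ, Matrix.mul_apply]
    exact Commute.sum_left _ _ _ fun κ _ => (ih κ).mul_left ((h κ ν).smul_left _)

theorem pairMatrix_pow_mem (m : ℕ) (μ ν : Fin n) :
    (pairMatrix pairDeriv ^ m) μ ν ∈ diffOps (PIdx n) m := by
  induction m generalizing ν with
  | zero =>
    rw [pow_zero, Matrix.one_apply]
    split_ifs
    · exact one_mem_diffOps
    · exact zero_mem _
  | succ m ih =>
    rw [pow_succ, Matrix.mul_apply, Nat.cast_succ]
    exact sum_mem fun κ _ => mul_mem_diffOps (ih κ) (Submodule.smul_mem _ _ (pairDeriv_mem κ ν))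

theorem Apow_eq (m : ℕ) (μ ν : Fin n) (p : PolyP n) :
    Apow m μ ν p = (etaM ν ν • (pairMatrix pairDeriv ^ m) μ ν) p := by
  induction m generalizing ν p with
  | zero =>
    rw [pow_zero, Matrix.one_apply]
    change etaM μ ν • p = _
    by_cases h : μ = ν
    · subst h
      simp
    · rw [etaM_eq μ ν, if_neg h, if_neg h, zero_smul, smul_zero, LinearMap.zero_apply]
  | succ m ih =>
    simp only [Apow, sum_etaM_smul, ih, ← pairDeriv_apply]
    rw [pow_succ, Matrix.mul_apply, smul_sum, LinearMap.sum_apply]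
    refine sum_congr rfl fun κ _ => ?_
    rw [LinearMap.smul_apply, smul_smul, etaM_self_mul_self, one_smul, pairMatrix_apply,
      mul_smul_comm, smul_smul, etaM_self_mul_self, one_smul]
    rfl

theorem dmatpowL_eq_Apow (m : ℕ) : dmatpowL (n := n) m = Apow m := by
  induction m with
  | zero => rfl
  | succ m ih =>
    funext μ ν p
    simp only [dmatpowL, Apow, ih]

theorem Dblock_eq (μ ν α β : Fin n) (p : PolyP n) :
    Dblock μ ν α β p = pairBlock pairDeriv μ ν α β p := by
  simp only [Dblock, ← pairDeriv_apply]
  rfl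

theorem pairBlock_mem (μ ν α β : Fin n) :
    pairBlock pairDeriv μ ν α β ∈ diffOps (PIdx n) 1 :=
  Submodule.smul_mem _ _ (sub_mem (add_mem (sub_mem
    (Submodule.smul_mem _ _ (pairDeriv_mem _ _)) (Submodule.smul_mem _ _ (pairDeriv_mem _ _)))
    (Submodule.smul_mem _ _ (pairDeriv_mem _ _))) (Submodule.smul_mem _ _ (pairDeriv_mem _ _)))

theorem Dpow_eq (m : ℕ) (μ ν α β : Fin n) (p : PolyP n) :
    Dpow m μ ν α β p = pairBlockPow pairDeriv m μ ν α β p := by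
  induction m generalizing μ ν with
  | zero => rfl
  | succ m ih =>
    simp only [Dpow, sum_etaM_mul_etaM_smul, ih, Dblock_eq, pairBlockPow_succ,
      LinearMap.sum_apply, LinearMap.smul_apply]
    rfl

theorem pairBlockPow_mem (m : ℕ) (μ ν α β : Fin n) :
    pairBlockPow pairDeriv m μ ν α β ∈ diffOps (PIdx n) m := by
  induction m generalizing μ ν with
  | zero => exact Submodule.smul_mem _ _ one_mem_diffOps
  | succ m ih =>
    rw [pairBlockPow_succ, Nat.cast_succ, add_comm]
    exact sum_mem fun κ _ => sum_mem fun ρ _ =>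
      Submodule.smul_mem _ _ (mul_mem_diffOps (pairBlock_mem _ _ _ _) (ih κ ρ))

/-- The block `C_{(μν)α}` as a linear operator. -/
noncomputable def pairSingleBlock (μ ν α : Fin n) : Module.End ℝ (PolyP n) :=
  etaM α μ • singleDeriv ν - etaM α ν • singleDeriv μ

/-- The pair-single block of the `m`-th power as a linear operator. -/
noncomputable def pairSinglePow : ℕ → Fin n → Fin n → Fin n → Module.End ℝ (PolyP n)
  | 0 => fun _ _ _ => 0
  | m + 1 => fun μ ν α =>
      ∑ κ, etaM κ κ • (pairSingleBlock μ ν κ * (etaM α α • (pairMatrix pairDeriv ^ m) κ α)) +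
        ∑ θ, ∑ τ, (etaM θ θ * etaM τ τ) •
          (pairBlock pairDeriv μ ν θ τ * pairSinglePow m θ τ α)

theorem LLpow_eq (m : ℕ) (μ ν α : Fin n) (p : PolyP n) :
    LLpow m μ ν α p = pairSinglePow m μ ν α p := by
  induction m generalizing μ ν with
  | zero => rfl
  | succ m ih =>
    simp only [LLpow, sum_etaM_mul_etaM_smul, sum_etaM_smul, ih, Dblock_eq, Apow_eq,
      pairSinglePow, LinearMap.add_apply, LinearMap.sum_apply, LinearMap.smul_apply]
    rfl

theorem pairSinglePow_mem (m : ℕ) (μ ν α : Fin n) :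
    pairSinglePow m μ ν α ∈ diffOps (PIdx n) m := by
  induction m generalizing μ ν with
  | zero => exact zero_mem _
  | succ m ih =>
    rw [pairSinglePow, Nat.cast_succ, add_comm (m : ℤ)]
    refine add_mem (sum_mem fun κ _ => ?_) (sum_mem fun θ _ => sum_mem fun τ _ => ?_)
    · exact Submodule.smul_mem _ _ (mul_mem_diffOps
        (sub_mem (Submodule.smul_mem _ _ (singleDeriv_mem _))
          (Submodule.smul_mem _ _ (singleDeriv_mem _)))
        (Submodule.smul_mem _ _ (pairMatrix_pow_mem m κ α)))
    · exact Submodule.smul_mem _ _ (mul_mem_diffOps (pairBlock_mem _ _ _ _) (ih θ τ))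

theorem pairDeriv_commute_pvar_mul (γ δ α : Fin n) {d : ℤ} {T : Module.End ℝ (PolyP n)}
    (hT : T ∈ diffOps (PIdx n) d) :
    Commute (pairDeriv γ δ) (LinearMap.mulLeft ℝ (pvar α) * T) := by
  refine Commute.mul_right ?_ (commute_of_mem_diffOps (pairDeriv_mem γ δ) hT)
  rw [commute_iff_eq, ← sub_eq_zero]
  refine (pairDeriv_mul_mulLeft γ δ (pvar α)).trans ?_
  rw [pairDeriv_pvar]
  exact LinearMap.ext fun p => zero_mul p

/-- The order `m` term of `Λ̂_{ρσ}`. -/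
noncomputable def angleTerm (ρ σ : Fin n) (m : ℕ) : Module.End ℝ (PolyP n) :=
  (m ! : ℝ)⁻¹ • (etaM σ σ • (pairMatrix pairDeriv ^ m) ρ σ)

/-- The order `k` term of `P̂_μ`. -/
noncomputable def momentumTerm (μ : Fin n) (k : ℕ) : Module.End ℝ (PolyP n) :=
  bcoef k • ∑ α, LinearMap.mulLeft ℝ (pvar α) * (pairMatrix pairDeriv ^ k) μ α

/-- The momentum part of the order `k` term of `M̂_{μν}`, without its coefficient. -/
noncomputable def rotationMomentumTerm (μ ν : Fin n) (k : ℕ) : Module.End ℝ (PolyP n) :=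
  ∑ α, etaM α α • (LinearMap.mulLeft ℝ (pvar α) * pairSinglePow k μ ν α)

/-- The order `k` term of `M̂_{μν}`, without its coefficient. -/
noncomputable def rotationTerm (μ ν : Fin n) (k : ℕ) : Module.End ℝ (PolyP n) :=
  ∑ α, ∑ β, (etaM α α * etaM β β) •
    (LinearMap.mulLeft ℝ (xv α β) * pairBlockPow pairDeriv k μ ν α β) +
    rotationMomentumTerm μ ν k

theorem angleTerm_mem (ρ σ : Fin n) (m : ℕ) : angleTerm ρ σ m ∈ diffOps (PIdx n) m :=
  Submodule.smul_mem _ _ (Submodule.smul_mem _ _ (pairMatrix_pow_mem m ρ σ))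

theorem isOpSeries_Lhat (ρ σ : Fin n) : IsOpSeries (Lhat ρ σ) (angleTerm ρ σ) where
  mem_lowering k := lowering_anti (by omega) (angleTerm_mem ρ σ k).1
  eq_sum z p hp K hK := by
    have h : Lhat ρ σ p = ∑ᶠ k, angleTerm ρ σ k p :=
      finsum_congr fun k => by
        rw [dmatpowL_eq_Apow, Apow_eq]
        rfl
    rw [h]
    exact finsum_eq_sum_range_of_mem_lowering (fun k => (angleTerm_mem ρ σ k).1) hp hK

theorem isOpSeries_Phat (μ : Fin n) : IsOpSeries (Phat μ) (momentumTerm μ) where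
  mem_lowering k := by
    rw [sub_eq_neg_add]
    exact Submodule.smul_mem _ _ (sum_mem fun α _ =>
      mul_mem_lowering (mulLeft_pvar_mem α) (pairMatrix_pow_mem k μ α).1)
  eq_sum z p hp K hK := by
    have h : ∀ α, psiA μ α p =
        ∑ k ∈ range K, bcoef k • etaM α α • (pairMatrix pairDeriv ^ k) μ α p := fun α => by
      have h' : psiA μ α p =
          ∑ᶠ k, (bcoef k • etaM α α • (pairMatrix pairDeriv ^ k) μ α) p :=
        finsum_congr fun k => by
          rw [Apow_eq]
          rfl
      rw [h']
      exact finsum_eq_sum_range_of_mem_lowering (fun k => Submodule.smul_mem _ _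
        (Submodule.smul_mem _ _ (pairMatrix_pow_mem k μ α).1)) hp hK
    simp only [Phat, sum_etaM_smul]
    simp only [h, mul_sum, smul_sum]
    rw [sum_comm]
    refine sum_congr rfl fun k _ => ?_
    rw [momentumTerm, LinearMap.smul_apply, LinearMap.sum_apply, smul_sum]
    refine sum_congr rfl fun α _ => ?_
    rw [mul_smul_comm, mul_smul_comm, smul_comm (etaM α α), smul_smul (etaM α α),
      etaM_self_mul_self, one_smul]
    rfl

theorem rotationMomentumTerm_mem (μ ν : Fin n) (k : ℕ) :
    rotationMomentumTerm μ ν k ∈ lowering (PIdx n) (k - 1) := by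
  rw [sub_eq_neg_add]
  exact sum_mem fun α _ => Submodule.smul_mem _ _
    (mul_mem_lowering (mulLeft_pvar_mem α) (pairSinglePow_mem k μ ν α).1)

theorem rotationTerm_mem (μ ν : Fin n) (k : ℕ) :
    rotationTerm μ ν k ∈ lowering (PIdx n) (k - 1) := by
  refine add_mem ?_ (rotationMomentumTerm_mem μ ν k)
  rw [sub_eq_neg_add]
  exact sum_mem fun α _ => sum_mem fun β _ => Submodule.smul_mem _ _
    (mul_mem_lowering (mulLeft_xv_mem α β) (pairBlockPow_mem k μ ν α β).1)

theorem isOpSeries_Mhat (μ ν : Fin n) :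
    IsOpSeries (Mhat μ ν) fun k => bcoef k • rotationTerm μ ν k where
  mem_lowering k := Submodule.smul_mem _ _ (rotationTerm_mem μ ν k)
  eq_sum z p hp K hK := by
    have hD : ∀ α β, psiD μ ν α β p =
        ∑ k ∈ range K, bcoef k • pairBlockPow pairDeriv k μ ν α β p := fun α β => by
      have h' : psiD μ ν α β p = ∑ᶠ k, (bcoef k • pairBlockPow pairDeriv k μ ν α β) p :=
        finsum_congr fun k => by
          rw [Dpow_eq]
          rfl
      rw [h']
      exact finsum_eq_sum_range_of_mem_lowering (fun k => Submodule.smul_mem _ _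
        (pairBlockPow_mem k μ ν α β).1) hp hK
    have hL : ∀ α, psiLL μ ν α p =
        ∑ k ∈ range K, bcoef k • pairSinglePow k μ ν α p := fun α => by
      have h' : psiLL μ ν α p = ∑ᶠ k, (bcoef k • pairSinglePow k μ ν α) p :=
        finsum_congr fun k => by
          rw [LLpow_eq]
          rfl
      rw [h']
      exact finsum_eq_sum_range_of_mem_lowering (fun k => Submodule.smul_mem _ _
        (pairSinglePow_mem k μ ν α).1) hp hK
    have hR : ∀ k, (bcoef k • rotationTerm μ ν k) p =
        ∑ α, ∑ β, (etaM α α * etaM β β) •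
          (xv α β * bcoef k • pairBlockPow pairDeriv k μ ν α β p) +
        ∑ α, etaM α α • (pvar α * bcoef k • pairSinglePow k μ ν α p) := fun k => by
      simp only [rotationTerm, rotationMomentumTerm, LinearMap.smul_apply, LinearMap.add_apply,
        LinearMap.sum_apply, smul_add, smul_sum, mul_smul_comm, smul_comm (bcoef k)]
      rfl
    simp only [Mhat, sum_etaM_mul_etaM_smul, sum_etaM_smul]
    simp only [hD, hL, hR, sum_add_distrib, mul_sum, smul_sum]
    congr 1
    · rw [sum_comm (s := range K)]
      exact sum_congr rfl fun α _ => sum_comm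
    · exact sum_comm

theorem commute_momentumTerm_angleTerm (μ ρ σ : Fin n) (k j : ℕ) :
    Commute (momentumTerm μ k) (angleTerm ρ σ j) :=
  (((commute_pairMatrix_pow (fun γ δ => (Commute.sum_right _ _ _ fun α _ =>
    pairDeriv_commute_pvar_mul γ δ α (pairMatrix_pow_mem k μ α)).smul_right (bcoef k))
      j ρ σ).smul_left _).smul_left _).symm

theorem commute_angleTerm (μ ν ρ σ : Fin n) (k j : ℕ) :
    Commute (angleTerm μ ν k) (angleTerm ρ σ j) :=
  commute_of_mem_diffOps (angleTerm_mem μ ν k) (angleTerm_mem ρ σ j)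

theorem sum_antidiagonal_rotationTerm (μ ν ρ σ : Fin n) (m : ℕ) :
    ∑ q ∈ antidiagonal (m + 1), ((bcoef q.1 • rotationTerm μ ν q.1) * angleTerm ρ σ q.2 -
      angleTerm ρ σ q.2 * (bcoef q.1 • rotationTerm μ ν q.1)) =
      etaM ν ρ • angleTerm μ σ m - etaM μ ρ • angleTerm ν σ m := by
  have hx : ∀ γ δ α β : Fin n, pairDeriv γ δ * LinearMap.mulLeft ℝ (xv α β) -
      LinearMap.mulLeft ℝ (xv α β) * pairDeriv γ δ =
      (etaM γ α * etaM δ β - etaM γ β * etaM δ α : ℝ) • (1 : Module.End ℝ (PolyP n)) :=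
    fun γ δ α β => by
      refine (pairDeriv_mul_mulLeft γ δ (xv α β)).trans (LinearMap.ext fun p => ?_)
      rw [pairDeriv_xv, LinearMap.mulLeft_apply, ← Algebra.smul_def]
      rfl
  have h := sum_antidiagonal_commutator pairDeriv_swap
    (fun μ ν α β => commute_of_mem_diffOps (pairDeriv_mem μ ν) (pairDeriv_mem α β)) hx
    (z := rotationMomentumTerm μ ν) (fun k γ δ => Commute.sum_right _ _ _ fun α _ =>
      (pairDeriv_commute_pvar_mul γ δ α (pairSinglePow_mem k μ ν α)).smul_right _)
    μ ν (y := rotationTerm μ ν) (fun _ => rfl) m ρ σ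
  have h' := congrArg (fun T => (etaM σ σ : ℝ) • T) h
  simp only [smul_sum] at h'
  refine (sum_congr rfl fun q _ => ?_).trans (h'.trans ?_)
  · rw [angleTerm, smul_smul, smul_mul_assoc, mul_smul_comm, smul_mul_assoc, mul_smul_comm]
    module
  · rw [angleTerm, angleTerm]
    module

end PoincareOperators

/-- the operators `P̂_μ, M̂_{μν}, Λ̂_{μν}` realize the Poincaré algebra
extended by quantum angles: `[M̂_{μν},Λ̂_{ρσ}] = η_{νρ}Λ̂_{μσ} - η_{μρ}Λ̂_{νσ}`,
`[P̂_μ,Λ̂_{ρσ}] = 0` and `[Λ̂_{μν},Λ̂_{ρσ}] = 0`. -/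
theorem statement19 (n : ℕ) (hn : 2 ≤ n) :
    (∀ μ ν ρ σ : Fin n,
      Mhat μ ν ∘ Lhat ρ σ - Lhat ρ σ ∘ Mhat μ ν
        = etaM ν ρ • Lhat μ σ - etaM μ ρ • Lhat ν σ) ∧
    (∀ μ ρ σ : Fin n, Phat μ ∘ Lhat ρ σ - Lhat ρ σ ∘ Phat μ = 0) ∧
    (∀ μ ν ρ σ : Fin n,
      Lhat μ ν ∘ Lhat ρ σ - Lhat ρ σ ∘ Lhat μ ν = 0) := by
  refine ⟨fun μ ν ρ σ => ?_, fun μ ρ σ => ?_, fun μ ν ρ σ => ?_⟩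
  · refine (isOpSeries_Mhat μ ν).commutator_eq (isOpSeries_Lhat ρ σ)
      (((isOpSeries_Lhat μ σ).smul (etaM ν ρ)).sub ((isOpSeries_Lhat ν σ).smul (etaM μ ρ)))
      (fun k j => ?_) ?_ (sum_antidiagonal_rotationTerm μ ν ρ σ)
    · have hM := Submodule.smul_mem _ (bcoef k) (rotationTerm_mem μ ν k)
      have hL := (angleTerm_mem ρ σ j).1
      refine sub_mem ?_ ?_
      · rw [add_sub_right_comm]
        exact mul_mem_lowering hM hL
      · rw [add_comm, add_sub_assoc]
        exact mul_mem_lowering hL hM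
    · rw [sub_eq_zero, angleTerm, pow_zero, Matrix.one_apply]
      split_ifs
      · exact ((Commute.one_right _).smul_right _).smul_right _
      · exact ((Commute.zero_right _).smul_right _).smul_right _
  · have h : ∀ k j, momentumTerm μ k * angleTerm ρ σ j - angleTerm ρ σ j * momentumTerm μ k = 0 :=
      fun k j => sub_eq_zero.2 (commute_momentumTerm_angleTerm μ ρ σ k j)
    exact (isOpSeries_Phat μ).commutator_eq (isOpSeries_Lhat ρ σ) isOpSeries_zero
      (fun k j => (h k j).symm ▸ zero_mem _) (h 0 0) fun _ => Finset.sum_eq_zero fun _ _ => h _ _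
  · have h : ∀ k j, angleTerm μ ν k * angleTerm ρ σ j - angleTerm ρ σ j * angleTerm μ ν k = 0 :=
      fun k j => sub_eq_zero.2 (commute_angleTerm μ ν ρ σ k j)
    exact (isOpSeries_Lhat μ ν).commutator_eq (isOpSeries_Lhat ρ σ) isOpSeries_zero
      (fun k j => (h k j).symm ▸ zero_mem _) (h 0 0) fun _ => Finset.sum_eq_zero fun _ _ => h _ _
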